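/- Let (G_i)_{i∈ℕ} be a sequence of abelian groups and let X = (∏_i G_i)/(⊕_i G_i). Then the subgroup ⋂_{n≥1} nX is divisible: for every x ∈ ⋂_{n≥1} nX and every positive integer m there exists y ∈ ⋂_{n≥1} nX with m·y = x. -/

import Mathlib

/-- The subgroup of finitely supported sequences in a product of abelian groups. -/
def finSupp (G : ℕ → Type*) [∀ i, AddCommGroup (G i)] : AddSubgroup (∀ i, G i) where
  carrier := {x | ∃ N, ∀ i, N ≤ i → x i = 0}
  zero_mem' := ⟨0, fun i _ => rfl⟩
  add_mem' := by
    rintro a b ⟨N, hN⟩ ⟨M, hM⟩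
    refine ⟨max N M, fun i hi => ?_⟩
    have h1 := hN i (le_trans (le_max_left _ _) hi)
    have h2 := hM i (le_trans (le_max_right _ _) hi)
    simp [Pi.add_apply, h1, h2]
  neg_mem' := by
    rintro a ⟨N, hN⟩
    exact ⟨N, fun i hi => by simp [hN i hi]⟩

theorem mk_eq_nsmul_iff (G : ℕ → Type*) [∀ i, AddCommGroup (G i)] (a b : ∀ i, G i) (n : ℕ) :
    ((a : (∀ i, G i) ⧸ finSupp G) = n • (b : (∀ i, G i) ⧸ finSupp G)) ↔
      ∃ N, ∀ i, N ≤ i → a i = n • b i := by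
  rw [← QuotientAddGroup.mk_nsmul, eq_comm, QuotientAddGroup.eq]
  change (∃ N, ∀ i, N ≤ i → -(n • b i) + a i = 0) ↔ _
  simp only [neg_add_eq_zero, eq_comm]

/-- In `X = (∏ G_i)/(⊕ G_i)` the subgroup `⋂ₙ nX` is divisible. -/
theorem prod_mod_sum_first_ulm_divisible (G : ℕ → Type*) [∀ i, AddCommGroup (G i)] :
    ∀ x : (∀ i, G i) ⧸ finSupp G,
      (∀ n : ℕ, 1 ≤ n → ∃ y : (∀ i, G i) ⧸ finSupp G, x = n • y) →
      ∀ m : ℕ, 0 < m →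
        ∃ y : (∀ i, G i) ⧸ finSupp G,
          (∀ n : ℕ, 1 ≤ n → ∃ z : (∀ i, G i) ⧸ finSupp G, y = n • z) ∧ m • y = x := by
  classical
  intro x hx m hm
  induction x using QuotientAddGroup.induction_on with
  | H a =>
  have h1 : ∀ k : ℕ, ∃ N, ∀ i, N ≤ i → ∃ w : G i, a i = (m * k.factorial) • w := by
    intro k
    obtain ⟨y, hy⟩ := hx (m * k.factorial) (Nat.mul_pos hm k.factorial_pos)
    induction y using QuotientAddGroup.induction_on with
    | H b =>
    obtain ⟨N, hN⟩ := (mk_eq_nsmul_iff G a b _).1 hy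
    exact ⟨N, fun i hi => ⟨b i, hN i hi⟩⟩
  let P : ∀ _ : ℕ, ℕ → Prop := fun i k => ∃ w : G i, a i = (m * k.factorial) • w
  let K : ℕ → ℕ := fun i => Nat.findGreatest (P i) i
  let w : ∀ i, G i := fun i => if h : P i (K i) then h.choose else 0
  have hK : ∀ k : ℕ, ∃ N, ∀ i, N ≤ i → k ≤ K i ∧ a i = (m * (K i).factorial) • w i := by
    intro k
    obtain ⟨N, hN⟩ := h1 k
    refine ⟨max N k, fun i hi => ?_⟩
    have hki : k ≤ i := le_trans (le_max_right _ _) hi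
    have hP : P i k := hN i (le_trans (le_max_left _ _) hi)
    have hPK : P i (K i) := Nat.findGreatest_spec hki hP
    refine ⟨Nat.le_findGreatest hki hP, ?_⟩
    have hw : w i = hPK.choose := dif_pos hPK
    rw [hw]
    exact hPK.choose_spec
  refine ⟨((fun i => (K i).factorial • w i : ∀ i, G i) : (∀ i, G i) ⧸ finSupp G), ?_, ?_⟩
  · intro n hn
    obtain ⟨N, hN⟩ := hK n
    refine ⟨((fun i => ((K i).factorial / n) • w i : ∀ i, G i) : (∀ i, G i) ⧸ finSupp G), ?_⟩
    rw [mk_eq_nsmul_iff]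
    refine ⟨N, fun i hi => ?_⟩
    have hd : n ∣ (K i).factorial := Nat.dvd_factorial hn (hN i hi).1
    simp only [← mul_nsmul']
    rw [Nat.mul_div_cancel' hd]
  · symm
    rw [mk_eq_nsmul_iff]
    obtain ⟨N, hN⟩ := hK 0
    refine ⟨N, fun i hi => ?_⟩
    rw [← mul_nsmul']
    exact (hN i hi).2
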